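/- For every ε > 0 there exists n₀ ≥ 1 such that for all n ≥ n₀, sup_{x∈ℝ} |gₙ′(x) − 1| ≤ ε, where gₙ′ denotes the derivative of gₙ(x) = g^{qₙ}(x) − pₙ. -/

import Mathlib

open Filter Topology

/-- Gauss-map orbit of `α`: `α₀ = α`, `αₙ₊₁ = 1 / fract(αₙ)`. -/
noncomputable def cfGauss (α : ℝ) : ℕ → ℝ
  | 0 => α
  | n + 1 => (Int.fract (cfGauss α n))⁻¹

/-- Partial quotients `aₙ` of the continued fraction of `α`. -/
noncomputable def cfA (α : ℝ) (n : ℕ) : ℤ := ⌊cfGauss α n⌋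

/-- Numerators `pₙ` of the convergents of `α`. -/
noncomputable def cfP (α : ℝ) : ℕ → ℤ
  | 0 => cfA α 0
  | 1 => cfA α 1 * cfA α 0 + 1
  | n + 2 => cfA α (n + 2) * cfP α (n + 1) + cfP α n

/-- Denominators `qₙ` of the convergents of `α` (as natural numbers). -/
noncomputable def cfQ (α : ℝ) : ℕ → ℕ
  | 0 => 1
  | 1 => (cfA α 1).toNat
  | n + 2 => (cfA α (n + 2)).toNat * cfQ α (n + 1) + cfQ α n

/-- `gₙ(x) = g^{qₙ}(x) − pₙ`. -/
noncomputable def cfIter (g : ℝ → ℝ) (α : ℝ) (n : ℕ) (x : ℝ) : ℝ :=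
  g^[cfQ α n] x - cfP α n

/-- Arithmetic data of two consecutive convergents. -/
structure CvPair (α : ℝ) (q Q : ℕ) (p P : ℤ) : Prop where
  qpos : 0 < q
  qle : q ≤ Q
  sgn : (0 < q * α - p ∧ Q * α - P < 0 ∧ 0 < (q * α - p) + (Q * α - P)) ∨
    (q * α - p < 0 ∧ 0 < Q * α - P ∧ (q * α - p) + (Q * α - P) < 0)
  best : ∀ k m : ℤ, |k| < Q → 0 ≤ k * α + m → k * α + m < |q * α - p| → k = 0 ∧ m = 0

theorem cfGauss_irr {α : ℝ} (hα : Irrational α) : ∀ n, Irrational (cfGauss α n)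
  | 0 => hα
  | n + 1 => by
    have h := cfGauss_irr hα n
    rw [cfGauss, irrational_inv_iff, Int.fract]
    exact h.sub_intCast _

theorem cfFract_pos {α : ℝ} (hα : Irrational α) (n : ℕ) : 0 < Int.fract (cfGauss α n) := by
  rcases (Int.fract_nonneg (cfGauss α n)).lt_or_eq with h | h
  · exact h
  · exfalso
    have h1 := cfGauss_irr hα (n+1)
    rw [cfGauss, ← h] at h1
    simp at h1

theorem cfA_pos {α : ℝ} (hα : Irrational α) (n : ℕ) : 1 ≤ cfA α (n+1) := by
  rw [cfA, Int.le_floor, cfGauss]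
  have := cfFract_pos hα n
  have h2 := Int.fract_lt_one (cfGauss α n)
  rw [Int.cast_one]
  exact (one_le_inv₀ this).2 h2.le

theorem cfQ_succ {α : ℝ} (hα : Irrational α) (n : ℕ) :
    (cfQ α (n+2) : ℤ) = cfA α (n+2) * cfQ α (n+1) + cfQ α n := by
  have := cfA_pos hα (n+1)
  rw [cfQ]; push_cast
  rw [Int.toNat_of_nonneg (by linarith)]

theorem cfQ_one {α : ℝ} (hα : Irrational α) : (cfQ α 1 : ℤ) = cfA α 1 := by
  have := cfA_pos hα 0
  rw [cfQ]; rw [Int.toNat_of_nonneg (by linarith)]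

theorem cfQ_pos {α : ℝ} (hα : Irrational α) : ∀ n, 0 < cfQ α n ∧ 0 < cfQ α (n+1)
  | 0 => by
    have := cfA_pos hα 0
    have h := cfQ_one hα
    refine ⟨by simp [cfQ], ?_⟩
    simp only [zero_add] at *
    omega
  | n+1 => by
    obtain ⟨h1, h2⟩ := cfQ_pos hα n
    refine ⟨h2, ?_⟩
    rw [cfQ]; omega

theorem cfQ_lt {α : ℝ} (hα : Irrational α) (n : ℕ) : cfQ α (n+1) < cfQ α (n+2) := by
  have h := cfQ_succ hα n
  have h1 := cfA_pos hα (n+1)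
  obtain ⟨h2, h3⟩ := cfQ_pos hα n
  have : (cfQ α (n+1) : ℤ) < cfQ α (n+2) := by
    rw [h]
    have : (0:ℤ) < cfQ α n := by exact_mod_cast h2
    nlinarith
  exact_mod_cast this

theorem cfQ_le {α : ℝ} (hα : Irrational α) : ∀ n, cfQ α n ≤ cfQ α (n+1)
  | 0 => by have := (cfQ_pos hα 0).2; simp only [cfQ] at *; omega
  | n+1 => (cfQ_lt hα n).le

theorem cfD_succ {α : ℝ} (hα : Irrational α) : ∀ n,
    (cfQ α (n+1) * α - cfP α (n+1) : ℝ) =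
      - Int.fract (cfGauss α (n+1)) * (cfQ α n * α - cfP α n)
  | 0 => by
    have h := cfQ_one hα
    have h' : (cfQ α 1 : ℝ) = cfA α 1 := by exact_mod_cast h
    have hf := cfFract_pos hα 0
    have e1 : cfGauss α 1 * Int.fract α = 1 := by
      rw [cfGauss, cfGauss]; exact inv_mul_cancel₀ hf.ne'
    have e2 : Int.fract α = α - cfA α 0 := by rw [Int.fract, cfA, cfGauss]
    have e3 : Int.fract (cfGauss α 1) = cfGauss α 1 - cfA α 1 := by rw [Int.fract, cfA]
    simp only [zero_add]
    rw [h', e3]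
    simp only [cfP, cfQ]
    rw [e2] at e1
    push_cast
    linear_combination e1
  | n+1 => by
    have ih := cfD_succ hα n
    have h := cfQ_succ hα n
    have h' : (cfQ α (n+2) : ℝ) = cfA α (n+2) * cfQ α (n+1) + cfQ α n := by exact_mod_cast h
    have hf := cfFract_pos hα (n+1)
    have e1 : cfGauss α (n+2) * Int.fract (cfGauss α (n+1)) = 1 := by
      rw [cfGauss]; exact inv_mul_cancel₀ hf.ne'
    have e3 : Int.fract (cfGauss α (n+2)) = cfGauss α (n+2) - cfA α (n+2) := by
      rw [Int.fract, cfA]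
    have hP : (cfP α (n+2) : ℝ) = cfA α (n+2) * cfP α (n+1) + cfP α n := by
      rw [cfP]; push_cast; ring
    show (cfQ α (n+2) * α - cfP α (n+2) : ℝ) =
      - Int.fract (cfGauss α (n+2)) * (cfQ α (n+1) * α - cfP α (n+1))
    rw [h', hP, e3]
    linear_combination (-(cfQ α n * α - cfP α n)) * e1 + cfGauss α (n+2) * ih

theorem cf_det {α : ℝ} (hα : Irrational α) : ∀ n,
    cfP α (n+1) * cfQ α n - cfP α n * cfQ α (n+1) = 1 ∨
    cfP α (n+1) * cfQ α n - cfP α n * cfQ α (n+1) = -1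
  | 0 => by
    left
    have h := cfQ_one hα
    simp only [zero_add]
    rw [h]
    simp only [cfP, cfQ]; push_cast; ring
  | n+1 => by
    have h := cfQ_succ hα n
    have e : cfP α (n+1+1) * cfQ α (n+1) - cfP α (n+1) * cfQ α (n+1+1) =
      -(cfP α (n+1) * cfQ α n - cfP α n * cfQ α (n+1)) := by
      show cfP α (n+2) * cfQ α (n+1) - cfP α (n+1) * cfQ α (n+2) = _
      rw [h, cfP]; ring
    rw [e]
    rcases cf_det hα n with h | h <;> rw [h] <;> simp

theorem cfD_lt {α : ℝ} (hα : Irrational α) : ∀ n,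
    0 < |(cfQ α n * α - cfP α n : ℝ)|
  | 0 => by
    have hf := cfFract_pos hα 0
    simp only [cfQ, cfP, cfA, cfGauss] at *
    rw [abs_pos]
    rw [Int.fract] at hf
    push_cast; rw [one_mul]; exact hf.ne'
  | n+1 => by
    rw [cfD_succ hα n, abs_mul, abs_neg]
    exact mul_pos (abs_pos.2 (cfFract_pos hα (n+1)).ne') (cfD_lt hα n)

theorem cv_pair {α : ℝ} (hα : Irrational α) (n : ℕ) :
    CvPair α (cfQ α n) (cfQ α (n+1)) (cfP α n) (cfP α (n+1)) := by
  obtain ⟨hq, hQ⟩ := cfQ_pos hα n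
  have hle := cfQ_le hα n
  have hD := cfD_lt hα n
  have hE := cfD_succ hα n
  have hf := cfFract_pos hα (n+1)
  have hf1 := Int.fract_lt_one (cfGauss α (n+1))
  have hdet := cf_det hα n
  have hsgn : (0 < cfQ α n * α - cfP α n ∧ cfQ α (n+1) * α - cfP α (n+1) < 0 ∧
      0 < (cfQ α n * α - cfP α n) + (cfQ α (n+1) * α - cfP α (n+1))) ∨
    (cfQ α n * α - cfP α n < 0 ∧ 0 < cfQ α (n+1) * α - cfP α (n+1) ∧
      (cfQ α n * α - cfP α n) + (cfQ α (n+1) * α - cfP α (n+1)) < 0) := by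
    rw [hE]
    rcases lt_or_gt_of_ne (abs_pos.1 hD) with h | h
    · right
      refine ⟨h, by nlinarith, by nlinarith⟩
    · left
      refine ⟨h, by nlinarith, by nlinarith⟩
  refine ⟨hq, hle, hsgn, ?_⟩
  clear hE hf hf1
  generalize cfQ α n = q at *
  generalize cfQ α (n+1) = Q at *
  generalize cfP α n = p at *
  generalize cfP α (n+1) = P at *
  intro k m hk h0 h1
  have huv : ∃ u v : ℤ, k = u * q + v * Q ∧ m = -(u * p + v * P) := by
    rcases hdet with h | h
    · refine ⟨k * P + m * Q, -(k * p + m * q), ?_, ?_⟩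
      · linear_combination (-k) * h
      · linear_combination (-m) * h
    · refine ⟨-(k * P + m * Q), (k * p + m * q), ?_, ?_⟩
      · linear_combination (k) * h
      · linear_combination (m) * h
  obtain ⟨u, v, rfl, rfl⟩ := huv
  have e : ((u * q + v * Q : ℤ) : ℝ) * α + ((-(u * p + v * P) : ℤ) : ℝ) =
    u * (q * α - p) + v * (Q * α - P) := by push_cast; ring
  rw [e] at h0 h1
  have hq' : (0:ℤ) < q := by exact_mod_cast hq
  have hQ' : (0:ℤ) < Q := by exact_mod_cast hQ
  rw [abs_lt] at hk
  generalize (q * α - p : ℝ) = D at *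
  generalize (Q * α - P : ℝ) = E at *
  have key : u = 0 ∧ v = 0 := by
    rcases lt_trichotomy u 0 with hu | hu | hu
    · exfalso
      have hv : 0 ≤ v := by
        by_contra hv
        have : v ≤ -1 := by omega
        nlinarith
      have hu' : (u : ℝ) ≤ -1 := by exact_mod_cast (by omega : u ≤ -1)
      have hv' : (0 : ℝ) ≤ v := by exact_mod_cast hv
      rcases hsgn with ⟨a, b, c⟩ | ⟨a, b, c⟩
      · nlinarith
      · rw [abs_of_neg a] at h1; nlinarith
    · refine ⟨hu, ?_⟩
      subst hu
      have : v < 1 := by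
        by_contra hv
        have : 1 ≤ v := by omega
        nlinarith
      have : -1 < v := by
        by_contra hv
        have : v ≤ -1 := by omega
        nlinarith
      omega
    · exfalso
      have hv : v ≤ 0 := by
        by_contra hv
        have : 1 ≤ v := by omega
        nlinarith
      have hu' : (1 : ℝ) ≤ u := by exact_mod_cast (by omega : 1 ≤ u)
      have hv' : (v : ℝ) ≤ 0 := by exact_mod_cast hv
      rcases hsgn with ⟨a, b, c⟩ | ⟨a, b, c⟩
      · rw [abs_of_pos a] at h1; nlinarith
      · nlinarith
  obtain ⟨rfl, rfl⟩ := key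
  simp

/-- Topological data of the lift. -/
structure LiftSys (f : ℝ → ℝ) (α : ℝ) : Prop where
  mono : StrictMono f
  surj : Function.Surjective f
  per : ∀ x, f (x + 1) = f x + 1
  irr : Irrational α
  rot : ∀ x : ℝ, Tendsto (fun m : ℕ => (f^[m] x - x) / m) atTop (𝓝 α)

namespace LiftSys

variable {f : ℝ → ℝ} {α : ℝ}

theorem per_int (h : LiftSys f α) (m : ℤ) (x : ℝ) : f (x + m) = f x + m := by
  induction m using Int.induction_on generalizing x with
  | zero => simp
  | succ i ih =>
    have := h.per (x + i)
    push_cast at *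
    rw [← add_assoc, this, ih]; ring
  | pred i ih =>
    have := h.per (x + (-i - 1))
    push_cast at *
    have e : x + (-(i:ℝ) - 1) + 1 = x + -i := by ring
    rw [e, ih] at this
    linarith

theorem iter_int (h : LiftSys f α) (l : ℕ) (m : ℤ) (x : ℝ) : f^[l] (x + m) = f^[l] x + m := by
  induction l with
  | zero => simp
  | succ l ih => rw [Function.iterate_succ_apply', ih, h.per_int, Function.iterate_succ_apply']

theorem iter_sub (h : LiftSys f α) (l : ℕ) (m : ℤ) (x : ℝ) : f^[l] (x - m) = f^[l] x - m := by
  have := h.iter_int l (-m) x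
  push_cast at this
  simpa [sub_eq_add_neg] using this

theorem imono (h : LiftSys f α) (l : ℕ) : StrictMono (f^[l]) := h.mono.iterate l

theorem isurj (h : LiftSys f α) (l : ℕ) : Function.Surjective (f^[l]) := h.surj.iterate l

theorem core_le (h : LiftSys f α) (c : ℕ) (d : ℤ) (x : ℝ) (hx : f^[c] x + d ≤ x) :
    c * α + d ≤ 0 := by
  rcases Nat.eq_zero_or_pos c with rfl | hc
  · simp at hx; simpa using hx
  have hk : ∀ k : ℕ, f^[c * k] x + k * d ≤ x := by
    intro k
    induction k with
    | zero => simp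
    | succ k ih =>
      rw [Nat.mul_succ, Nat.add_comm, Function.iterate_add_apply]
      have h1 := (h.imono c).monotone ih
      have h2 := h.iter_int c (k * d) (f^[c * k] x)
      push_cast at *
      rw [h2] at h1
      linarith
  have ht : Tendsto (fun k : ℕ => (f^[c * (k+1)] x - x) / ((c * (k+1) : ℕ) : ℝ)) atTop (𝓝 α) := by
    refine (h.rot x).comp (f := fun k : ℕ => c * (k+1)) ?_
    refine tendsto_atTop_mono (fun k => ?_) tendsto_id
    simp only [id]; nlinarith
  have hc' : (0:ℝ) < c := by exact_mod_cast hc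
  have : α ≤ -d / c := by
    refine le_of_tendsto' ht (fun k => ?_)
    have := hk (k+1)
    push_cast at *
    rw [div_le_div_iff₀ (by positivity) hc']
    nlinarith
  rw [le_div_iff₀ hc'] at this
  linarith

theorem core_ge (h : LiftSys f α) (c : ℕ) (d : ℤ) (x : ℝ) (hx : x ≤ f^[c] x + d) :
    0 ≤ c * α + d := by
  rcases Nat.eq_zero_or_pos c with rfl | hc
  · simp at hx; simpa using hx
  have hk : ∀ k : ℕ, x ≤ f^[c * k] x + k * d := by
    intro k
    induction k with
    | zero => simp
    | succ k ih =>
      rw [Nat.mul_succ, Nat.add_comm, Function.iterate_add_apply]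
      have h1 := (h.imono c).monotone ih
      have h2 := h.iter_int c (k * d) (f^[c * k] x)
      push_cast at *
      rw [h2] at h1
      linarith
  have ht : Tendsto (fun k : ℕ => (f^[c * (k+1)] x - x) / ((c * (k+1) : ℕ) : ℝ)) atTop (𝓝 α) := by
    refine (h.rot x).comp (f := fun k : ℕ => c * (k+1)) ?_
    refine tendsto_atTop_mono (fun k => ?_) tendsto_id
    simp only [id]; nlinarith
  have hc' : (0:ℝ) < c := by exact_mod_cast hc
  have : -d / c ≤ α := by
    refine ge_of_tendsto' ht (fun k => ?_)
    have := hk (k+1)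
    push_cast at *
    rw [div_le_div_iff₀ hc' (by positivity)]
    nlinarith
  rw [div_le_iff₀ hc'] at this
  linarith

/-- The orbit is ordered like the orbit of the rotation. -/
theorem ord_lt (h : LiftSys f α) (i j : ℕ) (a b : ℤ) (x : ℝ) (hlt : i * α + a < j * α + b) :
    f^[i] x + a < f^[j] x + b := by
  by_contra hc
  push Not at hc
  rcases le_total i j with hij | hij
  · obtain ⟨c, rfl⟩ := Nat.exists_eq_add_of_le hij
    have := h.core_le c (b - a) (f^[i] x) (by
      rw [← Function.iterate_add_apply, add_comm c i]; push_cast; linarith)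
    push_cast at *; nlinarith
  · obtain ⟨c, rfl⟩ := Nat.exists_eq_add_of_le hij
    have := h.core_ge c (a - b) (f^[j] x) (by
      rw [← Function.iterate_add_apply, add_comm c j]; push_cast; linarith)
    push_cast at *; nlinarith

theorem ord_le (h : LiftSys f α) (i j : ℕ) (a b : ℤ) (x : ℝ) (hlt : i * α + a ≤ j * α + b) :
    f^[i] x + a ≤ f^[j] x + b := by
  rcases hlt.lt_or_eq with hl | he
  · exact (h.ord_lt i j a b x hl).le
  · rcases eq_or_ne i j with rfl | hne
    · have : (a:ℝ) = b := by linarith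
      rw [this]
    · exfalso
      have hne' : ((i:ℤ) - j) ≠ 0 := by omega
      have hir := h.irr.intCast_mul hne'
      apply hir.ne_int (b - a)
      push_cast; linarith

theorem ord_lt_rev (h : LiftSys f α) (i j : ℕ) (a b : ℤ) (x : ℝ)
    (hlt : f^[i] x + a < f^[j] x + b) : i * α + a < j * α + b := by
  by_contra hc
  push Not at hc
  linarith [h.ord_le _ _ _ _ x hc]

theorem ord_le_rev (h : LiftSys f α) (i j : ℕ) (a b : ℤ) (x : ℝ)
    (hlt : f^[i] x + a ≤ f^[j] x + b) : i * α + a ≤ j * α + b := by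
  by_contra hc
  push Not at hc
  linarith [h.ord_lt _ _ _ _ x hc]

/-- Total length of intervals which are disjoint modulo one. -/
theorem sum_len (h : LiftSys f α) (Q : ℕ) (a b : ℝ) (hab : a ≤ b)
    (hd : ∀ i j : ℕ, i < Q → j < Q → ∀ m : ℤ, f^[j] a ≤ f^[i] a + m → f^[i] a + m < f^[j] b →
      i = j ∧ m = 0) :
    ∑ i ∈ Finset.range Q, (f^[i] b - f^[i] a) ≤ 1 := by
  rcases Nat.eq_zero_or_pos Q with rfl | hQ
  · simp
  -- shift into `[a, a+1)`
  set s : ℕ → ℤ := fun i => -⌊f^[i] a - a⌋ with hs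
  set A : ℕ → ℝ := fun i => f^[i] a + s i with hA
  set B : ℕ → ℝ := fun i => f^[i] b + s i with hB
  have hAa : ∀ i, a ≤ A i := by
    intro i
    have := Int.floor_le (f^[i] a - a)
    simp only [hA, hs]; push_cast; linarith
  have hA1 : ∀ i, A i < a + 1 := by
    intro i
    have := Int.lt_floor_add_one (f^[i] a - a)
    simp only [hA, hs]; push_cast; linarith
  have hB1 : ∀ i < Q, B i ≤ a + 1 := by
    intro i hi
    by_contra hc
    push Not at hc
    have h1 := hA1 i
    simp only [hA, hB] at hc h1
    have h2 := hd 0 i hQ hi (1 - s i) (by simp; linarith) (by simp; linarith)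
    obtain ⟨rfl, h3⟩ := h2
    have : s 0 = 0 := by simp [hs]
    omega
  have hdisj : (↑(Finset.range Q) : Set ℕ).PairwiseDisjoint (fun i => Set.Ico (A i) (B i)) := by
    have key : ∀ i j, i < Q → j < Q → i ≠ j → A j ≤ A i → Disjoint (Set.Ico (A i) (B i)) (Set.Ico (A j) (B j)) := by
      intro i j hi hj hij hle
      rw [Set.Ico_disjoint_Ico]
      have : B j ≤ A i := by
        by_contra hc
        push Not at hc
        simp only [hA, hB] at hc hle
        have := hd i j hi hj (s i - s j) (by push_cast; linarith) (by push_cast; linarith)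
        exact hij this.1
      exact (min_le_right _ _).trans (this.trans (le_max_left _ _))
    intro i hi j hj hij
    simp only [Finset.coe_range, Set.mem_Iio] at hi hj
    rcases le_total (A j) (A i) with hle | hle
    · exact key i j hi hj hij hle
    · exact (key j i hj hi hij.symm hle).symm
  have hm := MeasureTheory.measure_biUnion_finset (μ := MeasureTheory.volume) hdisj
    (fun i _ => measurableSet_Ico)
  have hsub : (⋃ i ∈ Finset.range Q, Set.Ico (A i) (B i)) ⊆ Set.Icc a (a+1) := by
    intro y hy
    simp only [Set.mem_iUnion, Finset.mem_range] at hy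
    obtain ⟨i, hi, hy⟩ := hy
    exact ⟨(hAa i).trans hy.1, hy.2.le.trans (hB1 i hi)⟩
  have hle := MeasureTheory.measure_mono (μ := MeasureTheory.volume) hsub
  rw [hm] at hle
  simp only [Real.volume_Ico, Real.volume_Icc] at hle
  rw [← ENNReal.ofReal_sum_of_nonneg] at hle
  · have h2 := (ENNReal.ofReal_le_ofReal_iff (by simp)).1 hle
    have e : ∀ i, B i - A i = f^[i] b - f^[i] a := fun i => by simp only [hA, hB]; ring
    simp only [e] at h2
    linarith
  · intro i _
    have := (h.imono i).monotone hab
    simp only [hA, hB]; linarith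

/-- Covering lemma. -/
theorem cover {N : ℕ} (hN : 0 < N) (e r : ℕ → ℝ)
    (hn : ∀ k < N, ∃ k' < N, ∃ m : ℤ, e k < e k' + m ∧ e k' + m ≤ r k) (y : ℝ) :
    ∃ k < N, ∃ m : ℤ, e k + m ≤ y ∧ y ≤ r k + m := by
  -- nearest translate to the left of y
  obtain ⟨k, hk, hmax⟩ := Finset.exists_max_image (Finset.range N)
    (fun k => e k + ⌊y - e k⌋) ⟨0, by simpa using hN⟩
  simp only [Finset.mem_range] at hk hmax
  refine ⟨k, hk, ⌊y - e k⌋, ?_, ?_⟩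
  · linarith [Int.floor_le (y - e k)]
  · obtain ⟨k', hk', m, h1, h2⟩ := hn k hk
    by_contra hc
    push Not at hc
    have h3 := hmax k' hk'
    have h4 : m + ⌊y - e k⌋ ≤ ⌊y - e k'⌋ := by
      rw [Int.le_floor]; push_cast; linarith
    have h5 : (m:ℝ) + ⌊y - e k⌋ ≤ ⌊y - e k'⌋ := by exact_mod_cast h4
    linarith

variable {q Q : ℕ} {p P : ℤ}

/-- The intervals between `x` and `G x`, `G = f^q - p`. -/
theorem sum_m (h : LiftSys f α) (c : CvPair α q Q p P) (x : ℝ) :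
    ∑ i ∈ Finset.range Q, |f^[i] (f^[q] x - p) - f^[i] x| ≤ 1 := by
  rcases c.sgn with ⟨hD, -, -⟩ | ⟨hD, -, -⟩
  · have hx : x < f^[q] x - p := by
      have := h.ord_lt 0 q 0 (-p) x (by push_cast; linarith)
      simpa [sub_eq_add_neg] using this
    have := h.sum_len Q x (f^[q] x - p) hx.le (by
      intro i j hi hj m h1 h2
      rw [h.iter_sub, ← Function.iterate_add_apply] at h2
      have h1' := h.ord_le_rev j i 0 m x (by simpa using h1)
      have h2' := h.ord_lt_rev i (j+q) m (-p) x (by push_cast; linarith)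
      have := c.best (i - j) m (by rw [abs_lt]; omega)
        (by push_cast at *; linarith) (by rw [abs_of_pos hD]; push_cast at *; linarith)
      omega)
    refine le_of_eq_of_le (Finset.sum_congr rfl fun i _ => ?_) this
    exact abs_of_pos (sub_pos.2 (h.imono i hx))
  · have hx : f^[q] x - p < x := by
      have := h.ord_lt q 0 (-p) 0 x (by push_cast; linarith)
      simpa [sub_eq_add_neg] using this
    have := h.sum_len Q (f^[q] x - p) x hx.le (by
      intro i j hi hj m h1 h2
      rw [h.iter_sub, ← Function.iterate_add_apply] at h1 h2
      rw [h.iter_sub, ← Function.iterate_add_apply] at h1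
      have h1' := h.ord_le_rev (j+q) (i+q) (-p) (m-p) x (by push_cast; linarith)
      have h2' := h.ord_lt_rev (i+q) j (m-p) 0 x (by push_cast; linarith)
      have := c.best (i - j) m (by rw [abs_lt]; omega)
        (by push_cast at *; linarith) (by rw [abs_of_neg hD]; push_cast at *; linarith)
      omega)
    refine le_of_eq_of_le (Finset.sum_congr rfl fun i _ => ?_) this
    rw [abs_sub_comm]
    exact abs_of_pos (sub_pos.2 (h.imono i hx))

theorem sum_m2 (h : LiftSys f α) (c : CvPair α q Q p P) (x : ℝ) :
    ∑ i ∈ Finset.range (2 * Q), |f^[i] (f^[q] x - p) - f^[i] x| ≤ 2 := by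
  rw [two_mul, Finset.sum_range_add]
  have h1 := h.sum_m c x
  have h2 := h.sum_m c (f^[Q] x)
  have : ∑ i ∈ Finset.range Q, |f^[Q + i] (f^[q] x - p) - f^[Q + i] x| ≤ 1 := by
    refine le_of_eq_of_le (Finset.sum_congr rfl fun i _ => ?_) h2
    rw [add_comm Q i, Function.iterate_add_apply, Function.iterate_add_apply, h.iter_sub Q,
      ← Function.iterate_add_apply f Q q, ← Function.iterate_add_apply f q Q, add_comm q Q]
  linarith

theorem iter_mem_uIcc (h : LiftSys f α) (i : ℕ) {a b y : ℝ} (hy : y ∈ Set.uIcc a b) :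
    f^[i] y ∈ Set.uIcc (f^[i] a) (f^[i] b) := by
  have hm := (h.imono i).monotone
  rw [Set.mem_uIcc] at *
  rcases hy with ⟨h1, h2⟩ | ⟨h1, h2⟩
  · exact Or.inl ⟨hm h1, hm h2⟩
  · exact Or.inr ⟨hm h1, hm h2⟩

/-- every point is the image of a point between `x` and `G x`. -/
theorem cover_m (h : LiftSys f α) (c : CvPair α q Q p P) (x y : ℝ) :
    ∃ k < 2 * Q, ∃ m : ℤ, ∃ z ∈ Set.uIcc x (f^[q] x - p), y = f^[k] z + m := by
  have hq := c.qpos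
  have hqQ := c.qle
  suffices H : ∃ k < Q + q, ∃ m : ℤ, y - m ∈ Set.uIcc (f^[k] x) (f^[k] (f^[q] x - p)) by
    obtain ⟨k, hk, m, hy⟩ := H
    obtain ⟨z, hz⟩ := h.isurj k (y - m)
    refine ⟨k, by omega, m, z, ?_, by rw [hz]; ring⟩
    rw [← hz] at hy
    rw [Set.mem_uIcc] at *
    simpa only [(h.imono k).le_iff_le] using hy
  rcases c.sgn with ⟨hD, hE, hDE⟩ | ⟨hD, hE, hDE⟩
  · obtain ⟨k, hk, m, h1, h2⟩ := cover (N := Q + q) (by omega) (fun k => f^[k] x)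
      (fun k => f^[k] (f^[q] x - p)) (by
        intro k hk
        simp only [h.iter_sub, ← Function.iterate_add_apply]
        rcases lt_or_ge k Q with hkQ | hkQ
        · refine ⟨k + q, by omega, -p, ?_, ?_⟩
          · have := h.ord_lt k (k+q) 0 (-p) x (by push_cast; linarith)
            simpa using this
          · push_cast; linarith
        · obtain ⟨d, rfl⟩ := Nat.exists_eq_add_of_le hkQ
          refine ⟨d, by omega, P, ?_, ?_⟩
          · have := h.ord_lt (Q+d) d 0 P x (by push_cast; linarith)
            simpa using this
          · have := h.ord_le d (Q+d+q) P (-p) x (by push_cast; linarith)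
            push_cast at this; linarith) y
    refine ⟨k, hk, m, Set.mem_uIcc.2 (Or.inl ⟨by linarith, by linarith⟩)⟩
  · obtain ⟨k, hk, m, h1, h2⟩ := cover (N := Q + q) (by omega) (fun k => f^[k] (f^[q] x - p))
      (fun k => f^[k] x) (by
        intro k hk
        simp only [h.iter_sub, ← Function.iterate_add_apply]
        rcases lt_or_ge k q with hkQ | hkQ
        · refine ⟨k + Q, by omega, -P, ?_, ?_⟩
          · have := h.ord_lt (k+q) (k+Q+q) (-p) (-p-P) x (by push_cast; linarith)
            push_cast at *; linarith
          · have := h.ord_le (k+Q+q) k (-p-P) 0 x (by push_cast; linarith)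
            push_cast at *; linarith
        · obtain ⟨d, rfl⟩ := Nat.exists_eq_add_of_le hkQ
          refine ⟨d, by omega, p, ?_, ?_⟩
          · have := h.ord_lt (q+d+q) (d+q) (-p) 0 x (by push_cast; linarith)
            push_cast at *; linarith
          · rw [add_comm d q]; linarith) y
    refine ⟨k, hk, m, Set.mem_uIcc.2 (Or.inr ⟨by linarith, by linarith⟩)⟩

/-- position of `H z`. -/
theorem H_mem (h : LiftSys f α) (c : CvPair α q Q p P) (z : ℝ) :
    ∃ x, f^[q] x - p = z ∧ f^[Q] z - P ∈ Set.uIcc x (f^[q] x - p) := by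
  obtain ⟨x, hx⟩ := h.isurj q (z + p)
  have hx' : f^[q] x - p = z := by linarith
  refine ⟨x, hx', ?_⟩
  rw [← hx', h.iter_sub, ← Function.iterate_add_apply, Set.mem_uIcc]
  rcases c.sgn with ⟨hD, hE, hDE⟩ | ⟨hD, hE, hDE⟩
  · left
    have h1 := h.ord_le 0 (Q+q) 0 (-p-P) x (by push_cast; linarith)
    have h2 := h.ord_le (Q+q) q (-p-P) (-p) x (by push_cast; linarith)
    simp only [Function.iterate_zero, id] at *
    push_cast at *
    constructor <;> linarith
  · right
    have h1 := h.ord_le (Q+q) 0 (-p-P) 0 x (by push_cast; linarith)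
    have h2 := h.ord_le q (Q+q) (-p) (-p-P) x (by push_cast; linarith)
    simp only [Function.iterate_zero, id] at *
    push_cast at *
    constructor <;> linarith

/-- position of `H⁻¹ x`. -/
theorem Hinv_mem (h : LiftSys f α) (c : CvPair α q Q p P) (x : ℝ) :
    ∃ z, f^[Q] z - P = x ∧ z ∈ Set.uIcc x (f^[q] x - p) := by
  obtain ⟨z, hz⟩ := h.isurj Q (x + P)
  have hz' : f^[Q] z - P = x := by linarith
  refine ⟨z, hz', ?_⟩
  rw [← hz', h.iter_sub, ← Function.iterate_add_apply, Set.mem_uIcc]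
  rcases c.sgn with ⟨hD, hE, hDE⟩ | ⟨hD, hE, hDE⟩
  · left
    have h1 := h.ord_le 0 (q+Q) 0 (-p-P) z (by push_cast; linarith)
    have h2 := h.ord_le Q 0 (-P) 0 z (by push_cast; linarith)
    simp only [Function.iterate_zero, id] at *
    push_cast at *
    constructor <;> linarith
  · right
    have h1 := h.ord_le (q+Q) 0 (-p-P) 0 z (by push_cast; linarith)
    have h2 := h.ord_le 0 Q 0 (-P) z (by push_cast; linarith)
    simp only [Function.iterate_zero, id] at *
    push_cast at *
    constructor <;> linarith

theorem m_pos (h : LiftSys f α) (c : CvPair α q Q p P) (x : ℝ) : 0 < |f^[q] x - p - x| := by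
  rw [abs_pos]
  rcases c.sgn with ⟨hD, -, -⟩ | ⟨hD, -, -⟩
  · have := h.ord_lt 0 q 0 (-p) x (by push_cast; linarith)
    simp at this
    intro h0; linarith
  · have := h.ord_lt q 0 (-p) 0 x (by push_cast; linarith)
    simp at this
    intro h0; linarith

end LiftSys

/-- Smooth data of the lift: derivative d, its logarithmic derivative η, and e the derivative of η. -/
structure SmoothSys (f d η e : ℝ → ℝ) (α L K : ℝ) : Prop where
  sys : LiftSys f α
  hf : ∀ x, HasDerivAt f (d x) x
  pos : ∀ x, 0 < d x
  hd : ∀ x, HasDerivAt d (d x * η x) x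
  hη : ∀ x, HasDerivAt η (e x) x
  hL : ∀ x, |η x| ≤ L
  hK : ∀ x, |e x - η x ^ 2 / 2| ≤ K
  perd : ∀ x, d (x + 1) = d x
  perη : ∀ x, η (x + 1) = η x

/-- derivative of the iterate -/
noncomputable def itD (f d : ℝ → ℝ) : ℕ → ℝ → ℝ
  | 0, _ => 1
  | l + 1, x => d (f^[l] x) * itD f d l x

/-- logarithmic derivative of `itD` -/
noncomputable def itW (f d η : ℝ → ℝ) : ℕ → ℝ → ℝ
  | 0, _ => 0
  | l + 1, x => itW f d η l x + η (f^[l] x) * itD f d l x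

/-- Schwarzian derivative of the iterate -/
noncomputable def itS (f d η e : ℝ → ℝ) : ℕ → ℝ → ℝ
  | 0, _ => 0
  | l + 1, x => itS f d η e l x +
      (e (f^[l] x) - η (f^[l] x) ^ 2 / 2) * itD f d l x ^ 2

namespace SmoothSys

variable {f d η e : ℝ → ℝ} {α L K : ℝ}

theorem D_pos (h : SmoothSys f d η e α L K) (l : ℕ) (x : ℝ) : 0 < itD f d l x := by
  induction l with
  | zero => simp [itD]
  | succ l ih => exact mul_pos (h.pos _) ih

theorem hasD (h : SmoothSys f d η e α L K) (l : ℕ) (x : ℝ) :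
    HasDerivAt (f^[l]) (itD f d l x) x := by
  induction l with
  | zero => exact hasDerivAt_id x
  | succ l ih =>
    rw [Function.iterate_succ']
    exact (h.hf _).comp x ih

theorem hasDD (h : SmoothSys f d η e α L K) (l : ℕ) (x : ℝ) :
    HasDerivAt (itD f d l) (itD f d l x * itW f d η l x) x := by
  induction l with
  | zero =>
    have := hasDerivAt_const x (1:ℝ)
    simpa [itD, itW] using this
  | succ l ih =>
    have h1 := ((h.hd (f^[l] x)).comp x (h.hasD l x)).mul ih
    refine h1.congr_deriv ?_
    simp only [itD, itW, Function.comp]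
    ring

theorem hasW (h : SmoothSys f d η e α L K) (l : ℕ) (x : ℝ) :
    HasDerivAt (itW f d η l) (itW f d η l x ^ 2 / 2 + itS f d η e l x) x := by
  induction l with
  | zero =>
    have := hasDerivAt_const x (0:ℝ)
    simpa [itW, itS] using this
  | succ l ih =>
    have h1 := ih.add (((h.hη (f^[l] x)).comp x (h.hasD l x)).mul (h.hasDD l x))
    refine h1.congr_deriv ?_
    simp only [itW, itS, Function.comp]
    ring

theorem hasLog (h : SmoothSys f d η e α L K) (l : ℕ) (x : ℝ) :
    HasDerivAt (fun x => Real.log (itD f d l x)) (itW f d η l x) x := by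
  have := (h.hasDD l x).log (h.D_pos l x).ne'
  refine this.congr_deriv ?_
  field_simp [(h.D_pos l x).ne']

theorem D_add (_h : SmoothSys f d η e α L K) (k l : ℕ) (x : ℝ) :
    itD f d (k + l) x = itD f d l (f^[k] x) * itD f d k x := by
  induction l with
  | zero => simp [itD]
  | succ l ih =>
    rw [← add_assoc, itD, ih, itD, ← Function.iterate_add_apply, add_comm l k]; ring

theorem perd_int (h : SmoothSys f d η e α L K) (m : ℤ) (x : ℝ) : d (x + m) = d x := by
  have := (Function.Periodic.int_mul (f := d) (c := 1) h.perd m) x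
  simpa using this

theorem D_int (h : SmoothSys f d η e α L K) (l : ℕ) (m : ℤ) (x : ℝ) :
    itD f d l (x + m) = itD f d l x := by
  induction l with
  | zero => simp [itD]
  | succ l ih => rw [itD, ih, itD, h.sys.iter_int, h.perd_int]

theorem W_per (h : SmoothSys f d η e α L K) (l : ℕ) :
    Function.Periodic (itW f d η l) 1 := by
  intro x
  induction l with
  | zero => simp [itW]
  | succ l ih =>
    have h1 := h.sys.iter_int l 1 x
    have h2 := h.D_int l 1 x
    push_cast at h1 h2
    rw [itW, ih, h2, h1, h.perη, itW]

theorem L_nonneg (h : SmoothSys f d η e α L K) : 0 ≤ L := (abs_nonneg _).trans (h.hL 0)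

theorem K_nonneg (h : SmoothSys f d η e α L K) : 0 ≤ K := (abs_nonneg _).trans (h.hK 0)

/-- mean value inequality -/
theorem mvi {u v : ℝ → ℝ} {C : ℝ} (hu : ∀ x, HasDerivAt u (v x) x) (hC : ∀ x, |v x| ≤ C)
    (x y : ℝ) : |u y - u x| ≤ C * |y - x| := by
  have := Convex.norm_image_sub_le_of_norm_hasDerivWithin_le (s := Set.univ) (f := u) (f' := v)
    (C := C) (x := x) (y := y) (fun x _ => (hu x).hasDerivWithinAt) (fun x _ => hC x) convex_univ
    trivial trivial
  simpa using this

theorem log_lip (h : SmoothSys f d η e α L K) (l : ℕ) (y z : ℝ) :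
    |Real.log (itD f d l y) - Real.log (itD f d l z)| ≤
      L * ∑ i ∈ Finset.range l, |f^[i] y - f^[i] z| := by
  induction l with
  | zero => simp [itD]
  | succ l ih =>
    have h1 : ∀ x, HasDerivAt (fun x => Real.log (d x)) (η x) x := by
      intro x
      refine ((h.hd x).log (h.pos x).ne').congr_deriv ?_
      field_simp [(h.pos x).ne']
    have h2 := mvi h1 h.hL (f^[l] z) (f^[l] y)
    rw [Finset.sum_range_succ, itD, itD, Real.log_mul (h.pos _).ne' (h.D_pos _ _).ne',
      Real.log_mul (h.pos _).ne' (h.D_pos _ _).ne']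
    have h3 := abs_add_le (Real.log (d (f^[l] y)) - Real.log (d (f^[l] z)))
      (Real.log (itD f d l y) - Real.log (itD f d l z))
    rw [show Real.log (d (f^[l] y)) + Real.log (itD f d l y) -
      (Real.log (d (f^[l] z)) + Real.log (itD f d l z)) =
      (Real.log (d (f^[l] y)) - Real.log (d (f^[l] z))) +
      (Real.log (itD f d l y) - Real.log (itD f d l z)) by ring]
    linarith

variable {q Q : ℕ} {p P : ℤ}

/-- bounded distortion -/
theorem distort (h : SmoothSys f d η e α L K) (c : CvPair α q Q p P) (x : ℝ) {l : ℕ}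
    (hl : l ≤ 2 * Q) {y z : ℝ} (hy : y ∈ Set.uIcc x (f^[q] x - p))
    (hz : z ∈ Set.uIcc x (f^[q] x - p)) :
    |Real.log (itD f d l y) - Real.log (itD f d l z)| ≤ 2 * L := by
  refine (h.log_lip l y z).trans ?_
  have h1 : ∑ i ∈ Finset.range l, |f^[i] y - f^[i] z| ≤
      ∑ i ∈ Finset.range (2 * Q), |f^[i] (f^[q] x - p) - f^[i] x| := by
    refine (Finset.sum_le_sum fun i _ => ?_).trans
      (Finset.sum_le_sum_of_subset_of_nonneg (Finset.range_mono hl) fun i _ _ => abs_nonneg _)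
    exact Set.abs_sub_le_of_uIcc_subset_uIcc
      (Set.uIcc_subset_uIcc (h.sys.iter_mem_uIcc i hz) (h.sys.iter_mem_uIcc i hy))
  have h2 := h.sys.sum_m2 c x
  have := h.L_nonneg
  nlinarith

theorem D_iter_H (h : SmoothSys f d η e α L K) (k : ℕ) (z : ℝ) (P : ℤ) :
    Real.log (itD f d Q (f^[k] z)) = Real.log (itD f d Q z) +
      (Real.log (itD f d k (f^[Q] z - P)) - Real.log (itD f d k z)) := by
  have h1 := h.D_add k Q z
  have h2 := h.D_add Q k z
  have h3 : itD f d k (f^[Q] z - P) = itD f d k (f^[Q] z) := by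
    have := h.D_int k (-P) (f^[Q] z)
    push_cast at this
    rw [sub_eq_add_neg, this]
  rw [h3]
  rw [add_comm k Q, h2] at h1
  have := congrArg Real.log h1
  rw [Real.log_mul (h.D_pos _ _).ne' (h.D_pos _ _).ne',
    Real.log_mul (h.D_pos _ _).ne' (h.D_pos _ _).ne'] at this
  linarith

/-- From local to global oscillation. -/
theorem osc (h : SmoothSys f d η e α L K) (c : CvPair α q Q p P) (x B : ℝ)
    (h1 : ∀ z ∈ Set.uIcc x (f^[q] x - p),
      |Real.log (itD f d Q z) - Real.log (itD f d Q x)| ≤ B)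
    (h2 : ∀ k < 2 * Q, ∀ z ∈ Set.uIcc x (f^[q] x - p),
      |Real.log (itD f d k (f^[Q] z - P)) - Real.log (itD f d k z)| ≤ B) (y : ℝ) :
    |Real.log (itD f d Q y)| ≤ 4 * B := by
  have key : ∀ y, |Real.log (itD f d Q y) - Real.log (itD f d Q x)| ≤ 2 * B := by
    intro y
    obtain ⟨k, hk, m, z, hz, rfl⟩ := h.sys.cover_m c x y
    rw [h.D_int, h.D_iter_H k z P]
    have h3 := h1 z hz
    have h4 := h2 k hk z hz
    rw [abs_le] at *
    constructor <;> linarith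
  obtain ⟨ξ, -, hξ⟩ := exists_hasDerivAt_eq_slope (f^[Q]) (itD f d Q) (zero_lt_one' ℝ)
    (fun x _ => (h.hasD Q x).continuousAt.continuousWithinAt) (fun x _ => h.hasD Q x)
  have h5 := h.sys.iter_int Q 1 0
  push_cast at h5
  rw [zero_add] at h5
  rw [h5] at hξ
  have h6 : itD f d Q ξ = 1 := by rw [hξ]; simp
  have h7 := key ξ
  have h8 := key y
  rw [h6, Real.log_one] at h7
  rw [abs_le] at *
  constructor <;> linarith

/-- Denjoy's inequality -/
theorem denjoy (h : SmoothSys f d η e α L K) (c : CvPair α q Q p P) (y : ℝ) :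
    |Real.log (itD f d Q y)| ≤ 8 * L := by
  have := h.osc c 0 (2 * L)
    (fun z hz => h.distort c 0 (by omega) hz Set.left_mem_uIcc)
    (fun k hk z _ => by
      obtain ⟨x, hx, hm⟩ := h.sys.H_mem c z
      refine h.distort c x hk.le hm ?_
      rw [hx]; exact Set.right_mem_uIcc) y
  linarith

theorem D_bounds (h : SmoothSys f d η e α L K) (c : CvPair α q Q p P) (y : ℝ) :
    Real.exp (-(8 * L)) ≤ itD f d Q y ∧ itD f d Q y ≤ Real.exp (8 * L) := by
  have := h.denjoy c y
  rw [abs_le] at this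
  rw [← Real.le_log_iff_exp_le (h.D_pos _ _), ← Real.log_le_iff_le_exp (h.D_pos _ _)]
  exact this

theorem lower (h : SmoothSys f d η e α L K) (c : CvPair α q Q p P) (x y : ℝ) :
    Real.exp (-(8 * L)) * |y - x| ≤ |f^[Q] y - f^[Q] x| := by
  wlog hxy : x ≤ y generalizing x y
  · have := this y x (le_of_not_ge hxy)
    rwa [abs_sub_comm x y, abs_sub_comm (f^[Q] x)] at this
  rcases hxy.eq_or_lt with rfl | hlt
  · simp
  obtain ⟨ξ, -, hξ⟩ := exists_hasDerivAt_eq_slope (f^[Q]) (itD f d Q) hlt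
    (fun x _ => (h.hasD Q x).continuousAt.continuousWithinAt) (fun x _ => h.hasD Q x)
  have h1 := (h.D_bounds c ξ).1
  rw [hξ, le_div_iff₀ (sub_pos.2 hlt)] at h1
  rw [abs_of_pos (sub_pos.2 hlt), abs_of_pos (sub_pos.2 (h.sys.imono Q hlt))]
  exact h1

theorem upper (h : SmoothSys f d η e α L K) (c : CvPair α q Q p P) (x y : ℝ) :
    |f^[Q] y - f^[Q] x| ≤ Real.exp (8 * L) * |y - x| :=
  mvi (h.hasD Q) (fun x => by rw [abs_of_pos (h.D_pos _ _)]; exact (h.D_bounds c x).2) x y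

/-- bound on the derivatives along the orbit -/
theorem D_le (h : SmoothSys f d η e α L K) (c : CvPair α q Q p P) (x : ℝ) {l : ℕ}
    (hl : l ≤ 2 * Q) :
    itD f d l x * |f^[q] x - p - x| ≤
      Real.exp (2 * L) * |f^[l] (f^[q] x - p) - f^[l] x| := by
  have hlow : ∀ ξ ∈ Set.uIcc x (f^[q] x - p), itD f d l x ≤ Real.exp (2 * L) * itD f d l ξ := by
    intro ξ hξ
    have h1 := h.distort c x hl (Set.left_mem_uIcc) hξ
    rw [abs_le] at h1
    rw [← Real.exp_log (h.D_pos l ξ), ← Real.exp_add, ← Real.log_le_iff_le_exp (h.D_pos _ _)]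
    linarith
  have hne : x ≠ f^[q] x - p := by
    intro h0
    have := h.sys.m_pos c x
    rw [← h0] at this; simp at this
  rcases lt_or_gt_of_ne hne with hlt | hlt
  · obtain ⟨ξ, hm, hξ⟩ := exists_hasDerivAt_eq_slope (f^[l]) (itD f d l) hlt
      (fun x _ => (h.hasD l x).continuousAt.continuousWithinAt) (fun x _ => h.hasD l x)
    have h1 := hlow ξ (Set.mem_uIcc.2 (Or.inl ⟨hm.1.le, hm.2.le⟩))
    rw [eq_div_iff (sub_pos.2 hlt).ne'] at hξ
    rw [abs_of_pos (sub_pos.2 hlt), ← hξ, abs_of_nonneg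
      (mul_nonneg (h.D_pos _ _).le (sub_pos.2 hlt).le), ← mul_assoc]
    exact mul_le_mul_of_nonneg_right h1 (sub_pos.2 hlt).le
  · obtain ⟨ξ, hm, hξ⟩ := exists_hasDerivAt_eq_slope (f^[l]) (itD f d l) hlt
      (fun x _ => (h.hasD l x).continuousAt.continuousWithinAt) (fun x _ => h.hasD l x)
    have h1 := hlow ξ (Set.mem_uIcc.2 (Or.inr ⟨hm.1.le, hm.2.le⟩))
    rw [eq_div_iff (sub_pos.2 hlt).ne'] at hξ
    rw [abs_sub_comm, abs_of_pos (sub_pos.2 hlt), abs_sub_comm (f^[l] (f^[q] x - p)), ← hξ,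
      abs_of_nonneg (mul_nonneg (h.D_pos _ _).le (sub_pos.2 hlt).le), ← mul_assoc]
    exact mul_le_mul_of_nonneg_right h1 (sub_pos.2 hlt).le

theorem m_comm (h : SmoothSys f d η e α L K) (l : ℕ) (x : ℝ) :
    f^[l] (f^[q] x - p) = f^[q] (f^[l] x) - p := by
  rw [h.sys.iter_sub, ← Function.iterate_add_apply, ← Function.iterate_add_apply, add_comm]

/-- bound on the Schwarzian -/
theorem S_le (h : SmoothSys f d η e α L K) (c : CvPair α q Q p P) {M : ℝ}
    (hM : ∀ x, |f^[q] x - p - x| ≤ M) (x : ℝ) {l : ℕ} (hl : l ≤ 2 * Q) :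
    |itS f d η e l x| * |f^[q] x - p - x| ^ 2 ≤ 2 * K * Real.exp (2 * L) ^ 2 * M := by
  have hK := h.K_nonneg
  have h1 : |itS f d η e l x| ≤ K * ∑ i ∈ Finset.range l, itD f d i x ^ 2 := by
    clear hl
    induction l with
    | zero => simp [itS]
    | succ l ih =>
      rw [itS, Finset.sum_range_succ, mul_add]
      refine (abs_add_le _ _).trans (add_le_add ih ?_)
      rw [abs_mul, abs_of_nonneg (sq_nonneg (itD f d l x))]
      exact mul_le_mul_of_nonneg_right (h.hK _) (sq_nonneg _)
  have h2 : (∑ i ∈ Finset.range l, itD f d i x ^ 2) * |f^[q] x - p - x| ^ 2 ≤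
      Real.exp (2 * L) ^ 2 * M * ∑ i ∈ Finset.range l, |f^[i] (f^[q] x - p) - f^[i] x| := by
    rw [Finset.sum_mul, Finset.mul_sum]
    refine Finset.sum_le_sum fun i hi => ?_
    have h3 := h.D_le c x (l := i) (by have := Finset.mem_range.1 hi; omega)
    have h4 : |f^[i] (f^[q] x - p) - f^[i] x| ≤ M := by rw [h.m_comm]; exact hM _
    have h0 := mul_nonneg (h.D_pos i x).le (abs_nonneg (f^[q] x - p - x))
    calc itD f d i x ^ 2 * |f^[q] x - p - x| ^ 2 = (itD f d i x * |f^[q] x - p - x|) ^ 2 := by ring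
      _ ≤ (Real.exp (2 * L) * |f^[i] (f^[q] x - p) - f^[i] x|) ^ 2 := by gcongr
      _ = Real.exp (2 * L) ^ 2 * |f^[i] (f^[q] x - p) - f^[i] x| *
          |f^[i] (f^[q] x - p) - f^[i] x| := by ring
      _ ≤ _ := by gcongr
  have h5 : ∑ i ∈ Finset.range l, |f^[i] (f^[q] x - p) - f^[i] x| ≤ 2 :=
    (Finset.sum_le_sum_of_subset_of_nonneg (Finset.range_mono hl) fun i _ _ => abs_nonneg _).trans
      (h.sys.sum_m2 c x)
  have hM0 : 0 ≤ M := (abs_nonneg _).trans (hM 0)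
  calc |itS f d η e l x| * |f^[q] x - p - x| ^ 2
      ≤ (K * ∑ i ∈ Finset.range l, itD f d i x ^ 2) * |f^[q] x - p - x| ^ 2 := by gcongr
    _ = K * ((∑ i ∈ Finset.range l, itD f d i x ^ 2) * |f^[q] x - p - x| ^ 2) := by ring
    _ ≤ K * (Real.exp (2 * L) ^ 2 * M * 2) := by
        refine mul_le_mul_of_nonneg_left (h2.trans ?_) hK
        gcongr
    _ = _ := by ring

theorem exists_max_per {u : ℝ → ℝ} (hu : Continuous u) (hp : Function.Periodic u 1) :
    ∃ x, ∀ y, u y ≤ u x := by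
  obtain ⟨x, -, hx⟩ := (isCompact_Icc (a := (0:ℝ)) (b := 1)).exists_isMaxOn ⟨0, by simp⟩
    hu.continuousOn
  refine ⟨x, fun y => ?_⟩
  obtain ⟨z, hz, hzy⟩ := hp.exists_mem_Ico₀ zero_lt_one y
  rw [hzy]
  exact hx (Set.Ico_subset_Icc_self hz)

/-- bound on the nonlinearity -/
theorem W_le (h : SmoothSys f d η e α L K) (c : CvPair α q Q p P) {M μ : ℝ}
    (hM : ∀ x, |f^[q] x - p - x| ≤ M) (hμ : ∀ x, μ ≤ |f^[q] x - p - x|) (hμ0 : 0 < μ)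
    {l : ℕ} (hl : l ≤ 2 * Q) (y : ℝ) :
    |itW f d η l y| * μ ≤ 2 * Real.sqrt (K * M) * Real.exp (2 * L) := by
  have hK := h.K_nonneg
  have hM0 : 0 ≤ M := (abs_nonneg _).trans (hM 0)
  have hc : Continuous (itW f d η l) :=
    continuous_iff_continuousAt.2 fun x => (h.hasW l x).continuousAt
  obtain ⟨x, hx⟩ := exists_max_per (u := fun x => itW f d η l x ^ 2) (by fun_prop)
    (fun x => by simp only [h.W_per l x])
  have hloc : IsLocalMax (fun x => itW f d η l x ^ 2) x := Filter.Eventually.of_forall hx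
  have hder := hloc.hasDerivAt_eq_zero ((h.hasW l x).pow 2)
  have hS := h.S_le c hM x hl
  have hsq : itW f d η l x ^ 2 ≤ 2 * |itS f d η e l x| := by
    rcases eq_or_ne (itW f d η l x) 0 with h0 | h0
    · rw [h0]
      have := abs_nonneg (itS f d η e l x)
      nlinarith
    · have : itW f d η l x ^ 2 / 2 + itS f d η e l x = 0 := by
        simp at hder
        tauto
      have h9 := neg_abs_le (itS f d η e l x)
      linarith
  have h3 : (|itW f d η l y| * μ) ^ 2 ≤ (2 * Real.sqrt (K * M) * Real.exp (2 * L)) ^ 2 := by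
    have e1 : (2 * Real.sqrt (K * M) * Real.exp (2 * L)) ^ 2 =
        2 * (2 * K * Real.exp (2 * L) ^ 2 * M) := by
      rw [mul_pow, mul_pow, Real.sq_sqrt (by positivity)]; ring
    rw [e1, mul_pow, sq_abs]
    have h4 : μ ^ 2 ≤ |f^[q] x - p - x| ^ 2 := by
      have := hμ x
      gcongr
    calc itW f d η l y ^ 2 * μ ^ 2 ≤ (2 * |itS f d η e l x|) * |f^[q] x - p - x| ^ 2 := by
          have := (hx y).trans hsq
          gcongr
      _ ≤ _ := by linarith
  exact le_of_sq_le_sq h3 (by positivity)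

/-- The main estimate. -/
theorem main (h : SmoothSys f d η e α L K) (c : CvPair α q Q p P) {M : ℝ}
    (hM : ∀ x, |f^[q] x - p - x| ≤ M) (y : ℝ) :
    |Real.log (itD f d Q y)| ≤
      4 * (2 * Real.sqrt (K * M) * Real.exp (2 * L) * (2 * Real.exp (8 * L) + 1)) := by
  have hc : Continuous (f^[q]) :=
    continuous_iff_continuousAt.2 fun x => (h.hasD q x).continuousAt
  obtain ⟨x, hx⟩ := exists_max_per (u := fun x => -|f^[q] x - p - x|) (by fun_prop)
    (fun x => by
      have := h.sys.iter_int q 1 x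
      push_cast at this
      simp only [this]; congr 2; ring)
  set μ := |f^[q] x - p - x| with hμdef
  have hμ : ∀ y, μ ≤ |f^[q] y - p - y| := fun y => by have := hx y; linarith
  have hμ0 : 0 < μ := h.sys.m_pos c x
  have hE : 1 ≤ Real.exp (8 * L) := Real.one_le_exp (by have := h.L_nonneg; linarith)
  set T := 2 * Real.sqrt (K * M) * Real.exp (2 * L) with hT
  have hT0 : 0 ≤ T := by positivity
  have hlip : ∀ l ≤ 2 * Q, ∀ a b : ℝ, |b - a| ≤ (2 * Real.exp (8 * L) + 1) * μ →
      |Real.log (itD f d l b) - Real.log (itD f d l a)| ≤ T * (2 * Real.exp (8 * L) + 1) := by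
    intro l hl a b hab
    have h1 := mvi (h.hasLog l) (C := T / μ)
      (fun x => (le_div_iff₀ hμ0).2 (h.W_le c hM hμ hμ0 hl x)) a b
    refine h1.trans ?_
    calc T / μ * |b - a| ≤ T / μ * ((2 * Real.exp (8 * L) + 1) * μ) := by gcongr
      _ = _ := by field_simp
  have hin : ∀ z ∈ Set.uIcc x (f^[q] x - p), |z - x| ≤ μ := fun z hz =>
    Set.abs_sub_left_of_mem_uIcc hz
  refine h.osc c x _ (fun z hz => ?_) (fun k hk z hz => ?_) y
  · refine hlip Q (by omega) x z ((hin z hz).trans ?_)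
    nlinarith
  · refine hlip k hk.le z _ ?_
    obtain ⟨w, hw, hwm⟩ := h.sys.Hinv_mem c x
    have h1 := h.upper c x z
    have h2 := h.upper c w x
    have h3 := hin z hz
    have h4 := hin w hwm
    rw [abs_sub_comm x w] at h2
    have h5 : Real.exp (8 * L) * |z - x| ≤ Real.exp (8 * L) * μ := by gcongr
    have h6 : Real.exp (8 * L) * |w - x| ≤ Real.exp (8 * L) * μ := by gcongr
    have e1 : f^[Q] z - P - z = (f^[Q] z - f^[Q] x) + (f^[Q] x - f^[Q] w) + (x - z) := by
      linarith
    rw [e1]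
    refine (abs_add_le _ _).trans ((add_le_add_left (abs_add_le _ _) _).trans ?_)
    rw [abs_sub_comm x z]
    linarith

end SmoothSys

theorem smooth_m_le {f d η e : ℝ → ℝ} {α L K : ℝ} (h : SmoothSys f d η e α L K) (n : ℕ)
    (hn : 0 < n) (x : ℝ) :
    |f^[cfQ α n] x - cfP α n - x| ≤ Real.exp (8 * L) / n := by
  have hα := h.sys.irr
  have hs := h.sys.sum_m (cv_pair hα n) x
  have hsm : StrictMono (fun k => cfQ α (k+1)) := strictMono_nat_of_lt_succ (cfQ_lt hα)
  have h1 : ∑ k ∈ Finset.range n, |f^[cfQ α (k+1)] (f^[cfQ α n] x - cfP α n) -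
      f^[cfQ α (k+1)] x| ≤ 1 := by
    refine le_trans ?_ hs
    rw [← Finset.sum_image (s := Finset.range n) (g := fun k => cfQ α (k+1))
      (f := fun i => |f^[i] (f^[cfQ α n] x - cfP α n) - f^[i] x|) (hsm.injective.injOn)]
    refine Finset.sum_le_sum_of_subset_of_nonneg ?_ fun i _ _ => abs_nonneg _
    intro i hi
    simp only [Finset.mem_image, Finset.mem_range] at *
    obtain ⟨k, hk, rfl⟩ := hi
    exact hsm hk
  have h2 : ∑ k ∈ Finset.range n, Real.exp (-(8 * L)) * |f^[cfQ α n] x - cfP α n - x| ≤ 1 :=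
    (Finset.sum_le_sum fun k _ => h.lower (cv_pair hα k) _ _).trans h1
  rw [Finset.sum_const, Finset.card_range, nsmul_eq_mul, Real.exp_neg] at h2
  have hn' : (0:ℝ) < n := by exact_mod_cast hn
  have hE := Real.exp_pos (8 * L)
  rw [le_div_iff₀ hn']
  calc |f^[cfQ α n] x - cfP α n - x| * n
      = Real.exp (8 * L) * (n * ((Real.exp (8 * L))⁻¹ * |f^[cfQ α n] x - cfP α n - x|)) := by
        field_simp
    _ ≤ Real.exp (8 * L) * 1 := by gcongr
    _ = _ := mul_one _

theorem exists_bound_per {u : ℝ → ℝ} (hu : Continuous u) (hp : Function.Periodic u 1) :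
    ∃ C, ∀ y, |u y| ≤ C := by
  obtain ⟨x, hx⟩ := SmoothSys.exists_max_per (u := fun x => |u x|) (by fun_prop)
    (fun x => by simp only [hp x])
  exact ⟨_, hx⟩

theorem exists_smoothSys (g : ℝ → ℝ) (hg : ContDiff ℝ 3 g) (hgder : ∀ x, 0 < deriv g x)
    {α : ℝ} (hs : LiftSys g α) :
    ∃ η e : ℝ → ℝ, ∃ L K : ℝ, SmoothSys g (deriv g) η e α L K := by
  have hd : ContDiff ℝ 2 (deriv g) := by
    have := (contDiff_succ_iff_deriv (n := 2) (f := g)).1 (hg.of_le (by norm_num))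
    exact this.2.2
  have hd2 : ContDiff ℝ 1 (deriv (deriv g)) := by
    have := (contDiff_succ_iff_deriv (n := 1) (f := deriv g)).1 (hd.of_le (by norm_num))
    exact this.2.2
  set η : ℝ → ℝ := fun x => deriv (deriv g) x / deriv g x with hη
  have hηc : ContDiff ℝ 1 η := hd2.div (hd.of_le (by norm_num)) (fun x => (hgder x).ne')
  have perder : ∀ (u : ℝ → ℝ) (c : ℝ), (∀ x, u (x + 1) = u x + c) →
      ∀ x, deriv u (x + 1) = deriv u x := by
    intro u c hu x
    rw [← deriv_comp_add_const, show (fun x => u (x + 1)) = fun x => u x + c from funext hu,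
      deriv_add_const]
  have p1 := perder g 1 hs.per
  have p2 := perder (deriv g) 0 (by simpa using p1)
  have pη : ∀ x, η (x + 1) = η x := fun x => by simp only [hη, p1, p2]
  have pe := perder η 0 (by simpa using pη)
  have ce : Continuous (deriv η) := hηc.continuous_deriv le_rfl
  have cη := hηc.continuous
  obtain ⟨L, hL⟩ := exists_bound_per cη pη
  obtain ⟨K, hK⟩ := exists_bound_per (u := fun x => deriv η x - η x ^ 2 / 2) (by fun_prop)
    (fun x => by simp only [pη, pe])
  refine ⟨η, deriv η, L, K, hs, ?_, hgder, ?_, ?_, hL, hK, p1, pη⟩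
  · exact fun x => (hg.differentiable (by norm_num) x).hasDerivAt
  · intro x
    refine ((hd.differentiable (by norm_num) x).hasDerivAt).congr_deriv ?_
    simp only [hη]
    have := (hgder x).ne'
    field_simp
  · exact fun x => (hηc.differentiable (by norm_num) x).hasDerivAt

/-- **The renormalized iterates have derivative close to 1.**
Let `g` be the lift of an orientation-preserving `C³` circle diffeomorphism with irrational
rotation number `α`.  For every `ε > 0` there is `n₀ ≥ 1` such that for all `n ≥ n₀`,
`sup_x |gₙ′(x) − 1| ≤ ε`, where `gₙ(x) = g^{qₙ}(x) − pₙ`. -/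
theorem deriv_renormalized_close_to_one
    (g : ℝ → ℝ) (hg : ContDiff ℝ 3 g) (hgmono : StrictMono g)
    (hgsurj : Function.Surjective g) (hgder : ∀ x, 0 < deriv g x)
    (hgper : ∀ x, g (x + 1) = g x + 1)
    (α : ℝ) (hα : Irrational α)
    (hrot : ∀ x : ℝ, Tendsto (fun m : ℕ => (g^[m] x - x) / m) atTop (𝓝 α)) :
    ∀ ε > (0 : ℝ), ∃ n₀ : ℕ, 1 ≤ n₀ ∧ ∀ n ≥ n₀, ∀ x : ℝ,
      |deriv (cfIter g α n) x - 1| ≤ ε := by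
  intro ε hε
  have hs : LiftSys g α := ⟨hgmono, hgsurj, hgper, hα, hrot⟩
  obtain ⟨η, e, L, K, h⟩ := exists_smoothSys g hg hgder hs
  have hlim : Tendsto (fun n : ℕ => 4 * (2 * Real.sqrt (K * (Real.exp (8 * L) / n)) *
      Real.exp (2 * L) * (2 * Real.exp (8 * L) + 1))) atTop (𝓝 0) := by
    have h1 : Tendsto (fun n : ℕ => Real.exp (8 * L) / (n : ℝ)) atTop (𝓝 0) :=
      tendsto_const_div_atTop_nhds_zero_nat _
    have h2 := ((Real.continuous_sqrt.tendsto _).comp (h1.const_mul K))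
    have h3 := ((((h2.const_mul 2).mul_const (Real.exp (2 * L))).mul_const
      (2 * Real.exp (8 * L) + 1)).const_mul 4)
    simpa using h3
  have hpos : (0:ℝ) < min 1 (ε / 2) := by positivity
  obtain ⟨N, hN⟩ := eventually_atTop.1 (hlim.eventually (ge_mem_nhds hpos))
  refine ⟨N + 2, by omega, fun n hn x => ?_⟩
  obtain ⟨k, rfl⟩ : ∃ k, n = k + 1 := ⟨n - 1, by omega⟩
  have hb := (h.main (cv_pair hα k) (smooth_m_le h k (by omega)) x).trans (hN k (by omega))
  have hder : deriv (cfIter g α (k+1)) x = itD g (deriv g) (cfQ α (k+1)) x :=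
    ((h.hasD (cfQ α (k+1)) x).sub_const _).deriv
  rw [hder]
  have h1 := Real.abs_exp_sub_one_le (hb.trans (min_le_left _ _))
  rw [Real.exp_log (h.D_pos _ _)] at h1
  have h2 := hb.trans (min_le_right _ _)
  linarith
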